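/- arXiv:1311.6702 — 4 statements merged into one kernel-verified Lean document; each statement's English description precedes it below -/
import Mathlib

section
/- Every positive definite even symmetric 4×4 integer matrix of half-integer surgery type with determinant 33 is congruent over GL(4, ℤ) to Q₁ = [[6, 0, 1, 0], [0, 2, 0, 1], [1, 0, 2, 0], [0, 1, 0, 2]] or to Q₂ = [[4, 2, 1, 0], [2, 4, 0, 1], [1, 0, 2, 0], [0, 1, 0, 2]]. Moreover, Q₁ and Q₂ are not congruent to each other over GL(4, ℤ). -/
open Matrix

/-- Two symmetric integer matrices are congruent over `GL(4, ℤ)` if `Uᵀ Q U = Q'` for some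
integer matrix `U` with unit determinant. -/
def CongruentGL4 (Q Q' : Matrix (Fin 4) (Fin 4) ℤ) : Prop :=
  ∃ U : Matrix (Fin 4) (Fin 4) ℤ, IsUnit U.det ∧ Uᵀ * Q * U = Q'

/-- The matrix of half-integer surgery type with upper left block `!![a, b; b, c]`. -/
def surgeryMatrix (a b c : ℤ) : Matrix (Fin 4) (Fin 4) ℤ :=
  !![a, b, 1, 0; b, c, 0, 1; 1, 0, 2, 0; 0, 1, 0, 2]

theorem CongruentGL4.trans {Q R S : Matrix (Fin 4) (Fin 4) ℤ} (h₁ : CongruentGL4 Q R)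
    (h₂ : CongruentGL4 R S) : CongruentGL4 Q S := by
  obtain ⟨U, hU, rfl⟩ := h₁
  obtain ⟨V, hV, rfl⟩ := h₂
  refine ⟨U * V, ?_, ?_⟩
  · rw [det_mul]
    exact hU.mul hV
  · simp only [transpose_mul, Matrix.mul_assoc]

theorem CongruentGL4.symm {Q R : Matrix (Fin 4) (Fin 4) ℤ} (h : CongruentGL4 Q R) :
    CongruentGL4 R Q := by
  obtain ⟨U, hU, rfl⟩ := h
  refine ⟨U⁻¹, isUnit_nonsing_inv_det U hU, ?_⟩
  have hUT : U⁻¹ᵀ * Uᵀ = 1 := by rw [← transpose_mul, mul_nonsing_inv U hU, transpose_one]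
  calc U⁻¹ᵀ * (Uᵀ * Q * U) * U⁻¹ = (U⁻¹ᵀ * Uᵀ) * Q * (U * U⁻¹) := by
        simp only [Matrix.mul_assoc]
    _ = Q := by rw [hUT, mul_nonsing_inv U hU, Matrix.one_mul, Matrix.mul_one]

theorem surgeryMatrix_refl (a b c : ℤ) :
    CongruentGL4 (surgeryMatrix a b c) (surgeryMatrix a b c) :=
  ⟨1, by simp, by simp⟩

theorem surgeryMatrix_swap (a b c : ℤ) :
    CongruentGL4 (surgeryMatrix a b c) (surgeryMatrix c b a) := by
  refine ⟨!![0, 1, 0, 0; 1, 0, 0, 0; 0, 0, 0, 1; 0, 0, 1, 0], by decide, ?_⟩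
  ext i j
  fin_cases i <;> fin_cases j <;>
    simp [surgeryMatrix, mul_apply, Fin.sum_univ_four]

theorem surgeryMatrix_neg (a b c : ℤ) :
    CongruentGL4 (surgeryMatrix a b c) (surgeryMatrix a (-b) c) := by
  refine ⟨!![1, 0, 0, 0; 0, -1, 0, 0; 0, 0, 1, 0; 0, 0, 0, -1], by decide, ?_⟩
  ext i j
  fin_cases i <;> fin_cases j <;>
    simp [surgeryMatrix, mul_apply, Fin.sum_univ_four]

theorem surgeryMatrix_shift (a b c : ℤ) :
    CongruentGL4 (surgeryMatrix a b c)
      (surgeryMatrix a (b - (2 * a - 1)) (c - 4 * b + 4 * a - 2)) := by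
  refine ⟨!![1, -2, 0, 0; 0, 1, 0, 0; 0, 1, 1, 0; 0, 0, 0, 1], by decide, ?_⟩
  ext i j
  fin_cases i <;> fin_cases j <;>
    simp [surgeryMatrix, mul_apply, Fin.sum_univ_four] <;> ring

theorem det_surgeryMatrix (a b c : ℤ) :
    (surgeryMatrix a b c).det = (2 * a - 1) * (2 * c - 1) - 4 * b ^ 2 := by
  simp [surgeryMatrix, det_succ_row_zero, Fin.sum_univ_succ, Fin.succAbove]
  ring

theorem reduced_det_thirtyThree {a b c : ℤ} (ha : Even a) (hc : Even c) (hb : 0 ≤ b)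
    (hba : b < a) (hac : a ≤ c) (h : (2 * a - 1) * (2 * c - 1) - 4 * b ^ 2 = 33) :
    a = 2 ∧ b = 0 ∧ c = 6 ∨ a = 4 ∧ b = 2 ∧ c = 4 := by
  have ha9 : a ≤ 9 := by nlinarith
  have ha0 : 0 < a := by omega
  obtain ⟨c, rfl⟩ := hc
  obtain ⟨a, rfl⟩ := ha
  have ha4 : a ≤ 4 := by omega
  have ha1 : 1 ≤ a := by omega
  interval_cases a <;> interval_cases b <;> omega

theorem surgeryMatrix_classification (n : ℕ) : ∀ a b c : ℤ, a + c ≤ n → Even a → Even c →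
    0 < a → 0 < c → (2 * a - 1) * (2 * c - 1) - 4 * b ^ 2 = 33 →
    CongruentGL4 (surgeryMatrix a b c) (surgeryMatrix 6 0 2) ∨
      CongruentGL4 (surgeryMatrix a b c) (surgeryMatrix 4 2 4) := by
  induction n with
  | zero => intros; omega
  | succ n ih =>
    intro a b c hn ha hc ha0 hc0 h
    wlog hb : 0 ≤ b generalizing b
    · exact (this (-b) (by rw [neg_sq, h]) (by omega)).imp
        (surgeryMatrix_neg a b c).trans (surgeryMatrix_neg a b c).trans
    wlog hac : a ≤ c generalizing a c
    · exact (this c a (by omega) hc ha hc0 ha0 (by linarith) (by omega)).imp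
        (surgeryMatrix_swap a b c).trans (surgeryMatrix_swap a b c).trans
    by_cases hba : b < a
    · obtain ⟨rfl, rfl, rfl⟩ | ⟨rfl, rfl, rfl⟩ := reduced_det_thirtyThree ha hc hb hba hac h
      · exact Or.inl (surgeryMatrix_swap 2 0 6)
      · exact Or.inr (surgeryMatrix_refl 4 2 4)
    · have hdet : (2 * a - 1) * (2 * (c - 4 * b + 4 * a - 2) - 1) -
          4 * (b - (2 * a - 1)) ^ 2 = 33 := by linear_combination h
      have hpos : 0 < 2 * (c - 4 * b + 4 * a - 2) - 1 := by
        have : 0 < (2 * a - 1) * (2 * (c - 4 * b + 4 * a - 2) - 1) := by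
          nlinarith [sq_nonneg (b - (2 * a - 1))]
        exact (pos_iff_pos_of_mul_pos this).1 (by omega)
      exact (ih a _ _ (by omega) ha (by grind) ha0 (by omega) hdet).imp
        (surgeryMatrix_shift a b c).trans (surgeryMatrix_shift a b c).trans

theorem roots_surgeryMatrix_four_two_four {x y z w : ℤ}
    (h : 4 * x ^ 2 + 4 * y ^ 2 + 2 * z ^ 2 + 2 * w ^ 2 + 4 * x * y + 2 * x * z + 2 * y * w = 2) :
    x = 0 ∧ y = 0 ∧ (z = 0 ∧ (w = 1 ∨ w = -1) ∨ w = 0 ∧ (z = 1 ∨ z = -1)) := by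
  have hx : x ^ 2 < 2 := by
    nlinarith [sq_nonneg (x + 2 * z), sq_nonneg (y + 2 * w), sq_nonneg (7 * y + 4 * x)]
  have hy : y ^ 2 < 2 := by
    nlinarith [sq_nonneg (x + 2 * z), sq_nonneg (y + 2 * w), sq_nonneg (7 * x + 4 * y)]
  have hx1 : x ≤ 1 := by nlinarith
  have hx2 : -1 ≤ x := by nlinarith
  have hy1 : y ≤ 1 := by nlinarith
  have hy2 : -1 ≤ y := by nlinarith
  have hxy : x = 0 ∧ y = 0 := by
    interval_cases x <;> interval_cases y <;>
      first
      | exact ⟨rfl, rfl⟩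
      | nlinarith [sq_nonneg (1 + 2 * z), sq_nonneg (1 - 2 * z), sq_nonneg (1 + 2 * w),
          sq_nonneg (1 - 2 * w), sq_nonneg z, sq_nonneg w]
  obtain ⟨rfl, rfl⟩ := hxy
  have hz1 : z ≤ 1 := by nlinarith
  have hz2 : -1 ≤ z := by nlinarith
  have hw1 : w ≤ 1 := by nlinarith
  have hw2 : -1 ≤ w := by nlinarith
  interval_cases z <;> interval_cases w <;> simp_all

theorem not_congruentGL4_surgeryMatrix :
    ¬ CongruentGL4 (surgeryMatrix 6 0 2) (surgeryMatrix 4 2 4) := by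
  intro h
  obtain ⟨U, -, hU⟩ := h.symm
  have h11 := congrFun (congrFun hU 1) 1
  have h33 := congrFun (congrFun hU 3) 3
  have h13 := congrFun (congrFun hU 1) 3
  simp [surgeryMatrix, mul_apply, Fin.sum_univ_four] at h11 h33 h13
  obtain ⟨h0, h1, h2⟩ := roots_surgeryMatrix_four_two_four
    (x := U 0 1) (y := U 1 1) (z := U 2 1) (w := U 3 1) (by linear_combination h11)
  obtain ⟨h0', h1', h2'⟩ := roots_surgeryMatrix_four_two_four
    (x := U 0 3) (y := U 1 3) (z := U 2 3) (w := U 3 3) (by linear_combination h33)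
  rw [h0, h1, h0', h1'] at h13
  obtain ⟨hz, hw | hw⟩ | ⟨hz, hw | hw⟩ := h2 <;>
    obtain ⟨hz', hw' | hw'⟩ | ⟨hz', hw' | hw'⟩ := h2' <;>
    simp [hz, hw, hz', hw'] at h13

/-- Every positive definite even symmetric `4 × 4` integer matrix of half-integer surgery
type with determinant `33` is congruent over `GL(4, ℤ)` to
`Q₁ = [[6,0,1,0],[0,2,0,1],[1,0,2,0],[0,1,0,2]]` or to
`Q₂ = [[4,2,1,0],[2,4,0,1],[1,0,2,0],[0,1,0,2]]`, and these two are not congruent to each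
other. -/
theorem classification_det_33_halfIntegerSurgeryType :
    (∀ Q : Matrix (Fin 4) (Fin 4) ℤ,
      (∃ a b c : ℤ, Q = !![a, b, 1, 0; b, c, 0, 1; 1, 0, 2, 0; 0, 1, 0, 2]) →
      (∀ i, Even (Q i i)) →
      (∀ x : Fin 4 → ℤ, x ≠ 0 → 0 < x ⬝ᵥ Q.mulVec x) →
      Q.det = 33 →
      CongruentGL4 Q !![6, 0, 1, 0; 0, 2, 0, 1; 1, 0, 2, 0; 0, 1, 0, 2] ∨
      CongruentGL4 Q !![4, 2, 1, 0; 2, 4, 0, 1; 1, 0, 2, 0; 0, 1, 0, 2]) ∧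
    ¬ CongruentGL4 !![6, 0, 1, 0; 0, 2, 0, 1; 1, 0, 2, 0; 0, 1, 0, 2]
        !![4, 2, 1, 0; 2, 4, 0, 1; 1, 0, 2, 0; 0, 1, 0, 2] := by
  refine ⟨?_, not_congruentGL4_surgeryMatrix⟩
  rintro Q ⟨a, b, c, rfl⟩ heven hpos hdet
  have ha : 0 < a := by
    simpa [dotProduct, mulVec, Fin.sum_univ_four] using hpos ![1, 0, 0, 0] (by simp)
  have hc : 0 < c := by
    simpa [dotProduct, mulVec, Fin.sum_univ_four] using hpos ![0, 1, 0, 0] (by simp)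
  exact surgeryMatrix_classification (a + c).toNat a b c (by omega)
    (by simpa using heven 0) (by simpa using heven 1) ha hc
    ((det_surgeryMatrix a b c).symm.trans hdet)
end

section
/- Every positive definite symmetric 4×4 integer matrix of half-integer surgery type with determinant 15 and with exactly one odd diagonal entry is congruent over GL(4, ℤ) to R₁ = [[3, 0, 1, 0], [0, 2, 0, 1], [1, 0, 2, 0], [0, 1, 0, 2]] or to R₂ = [[8, 0, 1, 0], [0, 1, 0, 1], [1, 0, 2, 0], [0, 1, 0, 2]]. -/
open Matrix

/-- Two symmetric integer matrices are congruent over `GL(4, ℤ)` if `Uᵀ Q U = Q'` for some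
integer matrix `U` with unit determinant. -/
def CongruentGL4' (Q Q' : Matrix (Fin 4) (Fin 4) ℤ) : Prop :=
  ∃ U : Matrix (Fin 4) (Fin 4) ℤ, IsUnit U.det ∧ Uᵀ * Q * U = Q'

theorem CongruentGL4'.refl (Q : Matrix (Fin 4) (Fin 4) ℤ) : CongruentGL4' Q Q :=
  ⟨1, by simp, by simp⟩

theorem CongruentGL4'.trans {P Q R : Matrix (Fin 4) (Fin 4) ℤ} (h : CongruentGL4' P Q)
    (h' : CongruentGL4' Q R) : CongruentGL4' P R := by
  obtain ⟨U, hU, rfl⟩ := h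
  obtain ⟨V, hV, rfl⟩ := h'
  refine ⟨U * V, ?_, ?_⟩
  · rw [det_mul]
    exact hU.mul hV
  · simp only [transpose_mul, Matrix.mul_assoc]

/-- The `4 × 4` matrix of half-integer surgery type with upper left block `!![a, b; b, c]`. -/
abbrev halfIntegerSurgery (a b c : ℤ) : Matrix (Fin 4) (Fin 4) ℤ :=
  !![a, b, 1, 0; b, c, 0, 1; 1, 0, 2, 0; 0, 1, 0, 2]

theorem det_halfIntegerSurgery (a b c : ℤ) :
    (halfIntegerSurgery a b c).det = (2 * a - 1) * (2 * c - 1) - 4 * b ^ 2 := by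
  simp [halfIntegerSurgery, det_succ_row_zero, Fin.sum_univ_succ, Fin.succAbove]
  ring

theorem congruent_halfIntegerSurgery_swap (a b c : ℤ) :
    CongruentGL4' (halfIntegerSurgery a b c) (halfIntegerSurgery c b a) := by
  refine ⟨!![0, 1, 0, 0; 1, 0, 0, 0; 0, 0, 0, 1; 0, 0, 1, 0], ?_, ?_⟩
  · simp [det_succ_row_zero, Fin.sum_univ_succ, Fin.succAbove]
  · ext i j
    fin_cases i <;> fin_cases j <;> simp [Matrix.mul_apply, Fin.sum_univ_succ]

theorem congruent_halfIntegerSurgery_shear (a b c k : ℤ) :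
    CongruentGL4' (halfIntegerSurgery a b c)
      (halfIntegerSurgery a (b + k * (2 * a - 1)) (c + 4 * k * b + 2 * k ^ 2 * (2 * a - 1))) := by
  refine ⟨!![1, 2 * k, 0, 0; 0, 1, 0, 0; 0, -k, 1, 0; 0, 0, 0, 1], ?_, ?_⟩
  · simp [det_succ_row_zero, Fin.sum_univ_succ, Fin.succAbove]
  · ext i j
    fin_cases i <;> fin_cases j <;> simp [Matrix.mul_apply, Fin.sum_univ_succ] <;> ring

/-- If `2 * |b|` exceeds `2 * a - 1`, a shear decreases the lower diagonal entry. -/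
theorem exists_congruent_halfIntegerSurgery_lt {a b c : ℤ} (ha : 1 ≤ a)
    (h : (2 * a - 1) * (2 * c - 1) - 4 * b ^ 2 = 15) (hb : 2 * a - 1 < 2 * |b|) :
    ∃ b' c' : ℤ, 1 ≤ c' ∧ c' < c ∧ (2 * a - 1) * (2 * c' - 1) - 4 * b' ^ 2 = 15 ∧
      CongruentGL4' (halfIntegerSurgery a b c) (halfIntegerSurgery a b' c') := by
  obtain ⟨k, hk, hkb⟩ : ∃ k : ℤ, k ^ 2 = 1 ∧ k * b = -|b| := by
    rcases abs_cases b with ⟨hb', -⟩ | ⟨hb', -⟩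
    · exact ⟨-1, by norm_num, by rw [hb']; ring⟩
    · exact ⟨1, by norm_num, by rw [hb']; ring⟩
  have hdet : (2 * a - 1) * (2 * (c + 4 * k * b + 2 * k ^ 2 * (2 * a - 1)) - 1)
      - 4 * (b + k * (2 * a - 1)) ^ 2 = 15 := by
    rw [← h]
    ring
  refine ⟨_, _, ?_, ?_, hdet, congruent_halfIntegerSurgery_shear a b c k⟩
  · by_contra! hc
    nlinarith [sq_nonneg (b + k * (2 * a - 1))]
  · rw [hk, mul_assoc, hkb]
    linarith

theorem congruent_halfIntegerSurgery_of_reduced {a b c : ℤ} (ha : 1 ≤ a) (hc : 1 ≤ c)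
    (h : (2 * a - 1) * (2 * c - 1) - 4 * b ^ 2 = 15)
    (hba : 2 * |b| ≤ 2 * a - 1) (hbc : 2 * |b| ≤ 2 * c - 1) :
    CongruentGL4' (halfIntegerSurgery a b c) (halfIntegerSurgery 3 0 2) ∨
      CongruentGL4' (halfIntegerSurgery a b c) (halfIntegerSurgery 8 0 1) := by
  have h₁ : |b| ≤ a - 1 := by omega
  have h₂ : |b| ≤ c - 1 := by omega
  have h₃ : |b| * |b| ≤ (a - 1) * (c - 1) := mul_le_mul h₁ h₂ (abs_nonneg b) (by omega)
  have hac : a + c ≤ 9 := by nlinarith [abs_mul_abs_self b]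
  obtain ⟨hb₁, hb₂⟩ := abs_le.mp h₁
  have ha' : a ≤ 8 := by omega
  have hc' : c ≤ 8 := by omega
  have key : b = 0 ∧ (a = 3 ∧ c = 2 ∨ a = 2 ∧ c = 3 ∨ a = 8 ∧ c = 1 ∨ a = 1 ∧ c = 8) := by
    clear h₃
    rw [abs_le] at h₁ h₂
    interval_cases a <;> interval_cases c <;> first | omega | (interval_cases b <;> omega)
  obtain ⟨rfl, ⟨rfl, rfl⟩ | ⟨rfl, rfl⟩ | ⟨rfl, rfl⟩ | ⟨rfl, rfl⟩⟩ := key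
  · exact .inl (.refl _)
  · exact .inl (congruent_halfIntegerSurgery_swap _ _ _)
  · exact .inr (.refl _)
  · exact .inr (congruent_halfIntegerSurgery_swap _ _ _)

theorem congruent_halfIntegerSurgery_of_det_eq {a b c : ℤ} (ha : 1 ≤ a) (hc : 1 ≤ c)
    (h : (2 * a - 1) * (2 * c - 1) - 4 * b ^ 2 = 15) :
    CongruentGL4' (halfIntegerSurgery a b c) (halfIntegerSurgery 3 0 2) ∨
      CongruentGL4' (halfIntegerSurgery a b c) (halfIntegerSurgery 8 0 1) := by
  induction hn : (a + c).toNat using Nat.strong_induction_on generalizing a b c with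
  | _ n ih =>
    by_cases hba : 2 * a - 1 < 2 * |b|
    · obtain ⟨b', c', hc', hlt, h', hcong⟩ := exists_congruent_halfIntegerSurgery_lt ha h hba
      exact (ih _ (by omega) ha hc' h' rfl).imp hcong.trans hcong.trans
    by_cases hbc : 2 * c - 1 < 2 * |b|
    · obtain ⟨b', a', ha', hlt, h', hcong⟩ :=
        exists_congruent_halfIntegerSurgery_lt (c := a) hc (by rw [← h]; ring) hbc
      have hcong' := (congruent_halfIntegerSurgery_swap a b c).trans hcong
      exact (ih _ (by omega) hc ha' h' rfl).imp hcong'.trans hcong'.trans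
    · exact congruent_halfIntegerSurgery_of_reduced ha hc h (not_lt.mp hba) (not_lt.mp hbc)

/-- Every positive definite symmetric `4 × 4` integer matrix of half-integer surgery type
with determinant `15` and exactly one odd diagonal entry is congruent over `GL(4, ℤ)` to
`R₁ = [[3,0,1,0],[0,2,0,1],[1,0,2,0],[0,1,0,2]]` or to
`R₂ = [[8,0,1,0],[0,1,0,1],[1,0,2,0],[0,1,0,2]]`. -/
theorem classification_det_15_one_odd_diagonal :
    ∀ Q : Matrix (Fin 4) (Fin 4) ℤ,
      (∃ a b c : ℤ, Q = !![a, b, 1, 0; b, c, 0, 1; 1, 0, 2, 0; 0, 1, 0, 2]) →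
      (∀ x : Fin 4 → ℤ, x ≠ 0 → 0 < x ⬝ᵥ Q.mulVec x) →
      Q.det = 15 →
      (Finset.univ.filter fun i : Fin 4 => Odd (Q i i)).card = 1 →
      CongruentGL4' Q !![3, 0, 1, 0; 0, 2, 0, 1; 1, 0, 2, 0; 0, 1, 0, 2] ∨
      CongruentGL4' Q !![8, 0, 1, 0; 0, 1, 0, 1; 1, 0, 2, 0; 0, 1, 0, 2] := by
  rintro _ ⟨a, b, c, rfl⟩ hpos hdet -
  have h := det_halfIntegerSurgery a b c
  rw [hdet] at h
  have ha : 0 < 2 * a - 1 := by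
    have := hpos ![2, 0, -1, 0] (fun h => by simpa using congrFun h 0)
    simp [dotProduct, mulVec, Fin.sum_univ_succ] at this
    linarith
  have hc : 0 < 2 * c - 1 := by
    by_contra! hc
    nlinarith [sq_nonneg b]
  exact congruent_halfIntegerSurgery_of_det_eq (by omega) (by omega) h.symm
end

section
/- Define d : ℤ/17ℤ → ℚ by d(0) = 0, d(±1) = 4/17, d(±2) = 16/17, d(±3) = 2/17, d(±4) = −4/17, d(±5) = −2/17, d(±6) = 8/17, d(±7) = −8/17, d(±8) = −16/17, and let (m₀, …, m₈) = (0, −8/17, 2/17, −4/17, 8/17, 4/17, 18/17, 16/17, 32/17). Then there is no group automorphism φ of ℤ/17ℤ and no ε ∈ {1, −1} such that the numbers t_i := m_i − ε·d(φ(i)) for i = 0, …, 8 (with i regarded as an element of ℤ/17ℤ) are all nonnegative even integers and satisfy t₀ ≤ t₁ ≤ … ≤ t₈. -/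
/-- The elements of `ℤ/17ℤ` by their representatives of least absolute value. -/
theorem zmod_seventeen_cases (a : ZMod 17) :
    a = 0 ∨ a = 1 ∨ a = -1 ∨ a = 2 ∨ a = -2 ∨ a = 3 ∨ a = -3 ∨ a = 4 ∨ a = -4 ∨ a = 5 ∨ a = -5 ∨
      a = 6 ∨ a = -6 ∨ a = 7 ∨ a = -7 ∨ a = 8 ∨ a = -8 := by
  revert a
  decide

/-- With `d` the correction terms of `L(17,4)` (the double branched cover of `8₃`) and `m`
the correction terms of `17/2` surgery on the unknot, there is no group automorphism `φ` of
`ℤ/17ℤ` and sign `ε ∈ {1, -1}` for which the differences `t i = m i - ε * d (φ i)`,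
`i = 0, …, 8`, are all nonnegative even integers and form a nondecreasing sequence. -/
theorem no_positive_even_monotone_matching_8_3 (d : ZMod 17 → ℚ) (m : Fin 9 → ℚ)
    (hd0 : d 0 = 0)
    (hd1 : d 1 = 4/17) (hdm1 : d (-1) = 4/17)
    (hd2 : d 2 = 16/17) (hdm2 : d (-2) = 16/17)
    (hd3 : d 3 = 2/17) (hdm3 : d (-3) = 2/17)
    (hd4 : d 4 = -4/17) (hdm4 : d (-4) = -4/17)
    (hd5 : d 5 = -2/17) (hdm5 : d (-5) = -2/17)
    (hd6 : d 6 = 8/17) (hdm6 : d (-6) = 8/17)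
    (hd7 : d 7 = -8/17) (hdm7 : d (-7) = -8/17)
    (hd8 : d 8 = -16/17) (hdm8 : d (-8) = -16/17)
    (hm0 : m 0 = 0) (hm1 : m 1 = -8/17) (hm2 : m 2 = 2/17) (hm3 : m 3 = -4/17)
    (hm4 : m 4 = 8/17) (hm5 : m 5 = 4/17) (hm6 : m 6 = 18/17) (hm7 : m 7 = 16/17)
    (hm8 : m 8 = 32/17) :
    ¬ ∃ (φ : ZMod 17 ≃+ ZMod 17) (ε : ℚ), (ε = 1 ∨ ε = -1) ∧
      (∀ i : Fin 9, ∃ n : ℤ, 0 ≤ n ∧ Even n ∧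
        m i - ε * d (φ ((i : ℕ) : ZMod 17)) = (n : ℚ)) ∧
      (∀ i j : Fin 9, i ≤ j →
        m i - ε * d (φ ((i : ℕ) : ZMod 17)) ≤ m j - ε * d (φ ((j : ℕ) : ZMod 17))) := by
  rintro ⟨φ, ε, hε, hint, hmono⟩
  obtain ⟨n, -, -, hn⟩ := hint 1
  have h67 := hmono 6 7 (by decide)
  have hφ (k : ℕ) : φ (k : ZMod 17) = k * φ 1 := by
    rw [← nsmul_one, map_nsmul, nsmul_eq_mul, nsmul_one]
  simp only [hφ] at hn h67
  generalize φ 1 = a at hn h67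
  have hn' : -8 / 17 - ε * d a = n := by simpa [hm1] using hn
  have hle : 18 / 17 - ε * d (6 * a) ≤ 16 / 17 - ε * d (7 * a) := by
    rw [← hm6, ← hm7]
    exact h67
  have hz (k : ℤ) (hk : ε * d a = 2 * k / 17) : -8 - 2 * k = 17 * n := by
    have : (-8 - 2 * k : ℚ) = 17 * n := by
      rw [← hn', hk]
      ring
    exact_mod_cast this
  -- Integrality at `1` forces `ε = 1`, `a = ±7` or `ε = -1`, `a = ±6`.
  have ha : (ε = 1 ∧ (a = 7 ∨ a = -7)) ∨ (ε = -1 ∧ (a = 6 ∨ a = -6)) := by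
    have hne (k : ℤ) (hk : d a = 2 * k / 17) (hk8 : |k| ≤ 8) :
        (ε = 1 ∧ k = -4) ∨ (ε = -1 ∧ k = 4) := by
      rw [abs_le] at hk8
      rcases hε with rfl | rfl
      · have := hz k (by rw [hk]; ring)
        exact .inl ⟨rfl, by lia⟩
      · have := hz (-k) (by rw [hk]; push_cast; ring)
        exact .inr ⟨rfl, by lia⟩
    rcases zmod_seventeen_cases a with rfl | rfl | rfl | rfl | rfl | rfl | rfl | rfl | rfl | rfl |
      rfl | rfl | rfl | rfl | rfl | rfl | rfl
    · simpa using hne 0 (by norm_num [hd0]) (by norm_num)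
    · simpa using hne 2 (by norm_num [hd1]) (by norm_num)
    · simpa using hne 2 (by norm_num [hdm1]) (by norm_num)
    · simpa using hne 8 (by norm_num [hd2]) (by norm_num)
    · simpa using hne 8 (by norm_num [hdm2]) (by norm_num)
    · simpa using hne 1 (by norm_num [hd3]) (by norm_num)
    · simpa using hne 1 (by norm_num [hdm3]) (by norm_num)
    · simpa using hne (-2) (by norm_num [hd4]) (by norm_num)
    · simpa using hne (-2) (by norm_num [hdm4]) (by norm_num)
    · simpa using hne (-1) (by norm_num [hd5]) (by norm_num)
    · simpa using hne (-1) (by norm_num [hdm5]) (by norm_num)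
    · exact .inr ⟨by simpa using hne 4 (by norm_num [hd6]) (by norm_num), .inl rfl⟩
    · exact .inr ⟨by simpa using hne 4 (by norm_num [hdm6]) (by norm_num), .inr rfl⟩
    · exact .inl ⟨by simpa using hne (-4) (by norm_num [hd7]) (by norm_num), .inl rfl⟩
    · exact .inl ⟨by simpa using hne (-4) (by norm_num [hdm7]) (by norm_num), .inr rfl⟩
    · simpa using hne (-8) (by norm_num [hd8]) (by norm_num)
    · simpa using hne (-8) (by norm_num [hdm8]) (by norm_num)
  -- In each case the difference is `2` at `6` but `0` at `7`.
  rcases ha with ⟨rfl, rfl | rfl⟩ | ⟨rfl, rfl | rfl⟩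
  · rw [show (6 * 7 : ZMod 17) = 8 by decide, show (7 * 7 : ZMod 17) = -2 by decide, hd8,
      hdm2] at hle
    norm_num at hle
  · rw [show (6 * -7 : ZMod 17) = -8 by decide, show (7 * -7 : ZMod 17) = 2 by decide, hdm8,
      hd2] at hle
    norm_num at hle
  · rw [show (6 * 6 : ZMod 17) = 2 by decide, show (7 * 6 : ZMod 17) = 8 by decide, hd2,
      hd8] at hle
    norm_num at hle
  · rw [show (6 * -6 : ZMod 17) = -2 by decide, show (7 * -6 : ZMod 17) = -8 by decide, hdm2,
      hdm8] at hle
    norm_num at hle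
end

section
/- Define D : ℤ/3ℤ × ℤ/9ℤ → ℚ by 18·D(r, c) given, for row index r ∈ ℤ/3ℤ and column index c ∈ ℤ/9ℤ, by: for r = 0 the values (−9, 19, −5, 27, 7, 7, 27, −5, 19) for c = 0, …, 8, and for r = 1 and r = 2 the values (3, −5, 7, 3, 19, 19, 3, 7, −5) for c = 0, …, 8. Then there is no subgroup H of ℤ/3ℤ × ℤ/9ℤ of order 9 admitting a surjective group homomorphism φ : H → ℤ/3ℤ such that D is constant on every fiber of φ. -/
/-- If the table of values of `18 * D` is the one of `9₃₅`, then `D` attains its value at `0`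
nowhere else. -/
theorem eq_zero_of_apply_eq_apply_zero {D : ZMod 3 × ZMod 9 → ℚ}
    (hD : ∀ (r : Fin 3) (c : Fin 9),
      18 * D (((r : ℕ) : ZMod 3), ((c : ℕ) : ZMod 9)) =
        ![![-9, 19, -5, 27, 7, 7, 27, -5, 19],
          ![3, -5, 7, 3, 19, 19, 3, 7, -5],
          ![3, -5, 7, 3, 19, 19, 3, 7, -5]] r c)
    {p : ZMod 3 × ZMod 9} (hp : D p = D 0) : p = 0 := by
  have h_zero : 18 * D 0 = -9 := by simpa [Prod.mk_zero_zero] using hD 0 0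
  obtain ⟨a, b⟩ := p
  have h := hD ⟨a.val, a.val_lt⟩ ⟨b.val, b.val_lt⟩
  simp only [ZMod.natCast_zmod_val] at h
  rw [hp, h_zero] at h
  change Fin 3 at a
  change Fin 9 at b
  fin_cases a <;> fin_cases b <;> first | rfl | (exfalso; revert h; norm_num [ZMod.val])

/-- With `D` the correction terms of the double branched cover of `9₃₅ = P(3,3,3)`
(first homology `ℤ/3ℤ ⊕ ℤ/9ℤ`, spin structure at `(0,0)`), given by the table of values
of `18·D`, there is no subgroup `H` of `ℤ/3ℤ × ℤ/9ℤ` of order `9` with a surjective group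
homomorphism `φ : H → ℤ/3ℤ` such that `D` is constant on every fiber of `φ`. -/
theorem no_constant_on_fibers_epimorphism_9_35 (D : ZMod 3 × ZMod 9 → ℚ)
    (hD : ∀ (r : Fin 3) (c : Fin 9),
      18 * D (((r : ℕ) : ZMod 3), ((c : ℕ) : ZMod 9)) =
        ![![-9, 19, -5, 27, 7, 7, 27, -5, 19],
          ![3, -5, 7, 3, 19, 19, 3, 7, -5],
          ![3, -5, 7, 3, 19, 19, 3, 7, -5]] r c) :
    ¬ ∃ H : AddSubgroup (ZMod 3 × ZMod 9), Nat.card H = 9 ∧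
      ∃ φ : H →+ ZMod 3, Function.Surjective φ ∧
        ∀ x y : H, φ x = φ y → D (x : ZMod 3 × ZMod 9) = D (y : ZMod 3 × ZMod 9) := by
  rintro ⟨H, hH, φ, -, hφ⟩
  have h_inj : Function.Injective φ := by
    refine (injective_iff_map_eq_zero φ).2 fun x hx => ?_
    exact Subtype.ext (eq_zero_of_apply_eq_apply_zero hD (hφ x 0 (by rw [hx, map_zero])))
  have h_card := Nat.card_le_card_of_injective φ h_inj
  rw [hH, Nat.card_zmod] at h_card
  omega
end
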